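/- Let (E, {f_i}_{i=1}^m) ∈ 𝓔 with convex hull I. If f_1(I) ∩ f_2(I) ≠ ∅ or f_{m−1}(I) ∩ f_m(I) ≠ ∅, then U_{ℵ₀}(E) is countably infinite. -/

import Mathlib

open Set Filter MeasureTheory

/-- A self-similar iterated function system on `ℝ` given by `m` similitudes
`f i x = r i * x + t i` (for `1 ≤ i ≤ m`, `m ≥ 3`), together with its attractor `E`:
the unique nonempty compact set with `E = ⋃_{i=1}^m f_i(E)`. -/
structure ClassE where
  m : ℕ
  r : ℕ → ℝ
  t : ℕ → ℝ
  E : Set ℝ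
  hm : 3 ≤ m
  hr : ∀ i, 1 ≤ i → i ≤ m → 0 < r i ∧ r i < 1
  hEne : E.Nonempty
  hEcpt : IsCompact E
  hEinv : E = ⋃ i ∈ Finset.Icc 1 m, (fun x => r i * x + t i) '' E

namespace ClassE

/-- The `i`-th similitude. -/
def f (S : ClassE) (i : ℕ) (x : ℝ) : ℝ := S.r i * x + S.t i

/-- Left endpoint `a` of the convex hull of `E`. -/
noncomputable def a (S : ClassE) : ℝ := sInf S.E

/-- Right endpoint `b` of the convex hull of `E`. -/
noncomputable def b (S : ClassE) : ℝ := sSup S.E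

/-- The convex hull `I = [a, b]` of `E`. -/
noncomputable def I (S : ClassE) : Set ℝ := Set.Icc S.a S.b

/-- Condition (A): `a = f_1(a) < f_2(a) < ⋯ < f_m(a) < f_m(b) = b`. -/
def condA (S : ClassE) : Prop :=
  S.f 1 S.a = S.a ∧ (∀ i, 1 ≤ i → i < S.m → S.f i S.a < S.f (i + 1) S.a) ∧
    S.f S.m S.a < S.f S.m S.b ∧ S.f S.m S.b = S.b

/-- Condition (B): `f_i(I) ∩ f_{i+2}(I) = ∅` for all `1 ≤ i ≤ m - 2`. -/
def condB (S : ClassE) : Prop :=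
  ∀ i, 1 ≤ i → i + 2 ≤ S.m → S.f i '' S.I ∩ S.f (i + 2) '' S.I = ∅

/-- Condition (C): there are `i, j ∈ {1, …, m-1}` with `f_i(I) ∩ f_{i+1}(I) = ∅` and
`f_j(I) ∩ f_{j+1}(I) ≠ ∅`. -/
def condC (S : ClassE) : Prop :=
  (∃ i, 1 ≤ i ∧ i + 1 ≤ S.m ∧ S.f i '' S.I ∩ S.f (i + 1) '' S.I = ∅) ∧
    (∃ j, 1 ≤ j ∧ j + 1 ≤ S.m ∧ S.f j '' S.I ∩ S.f (j + 1) '' S.I ≠ ∅)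

/-- Condition (D): whenever `f_i(I) ∩ f_{i+1}(I) ≠ ∅` there are `u, v ≥ 1` with
`f_i(I) ∩ f_{i+1}(I) = f_i ∘ f_m^u (I) = f_{i+1} ∘ f_1^v (I)`. -/
def condD (S : ClassE) : Prop :=
  ∀ i, 1 ≤ i → i + 1 ≤ S.m → S.f i '' S.I ∩ S.f (i + 1) '' S.I ≠ ∅ →
    ∃ u v : ℕ, 1 ≤ u ∧ 1 ≤ v ∧
      S.f i '' S.I ∩ S.f (i + 1) '' S.I = (S.f i ∘ (S.f S.m)^[u]) '' S.I ∧
      S.f i '' S.I ∩ S.f (i + 1) '' S.I = (S.f (i + 1) ∘ (S.f 1)^[v]) '' S.I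

/-- Membership in the class `𝓔`: conditions (A)–(D). -/
def goodE (S : ClassE) : Prop := S.condA ∧ S.condB ∧ S.condC ∧ S.condD

/-- `prefixMap d n = f_{d 0} ∘ f_{d 1} ∘ ⋯ ∘ f_{d (n-1)}`. -/
def prefixMap (S : ClassE) (d : ℕ → ℕ) : ℕ → ℝ → ℝ
  | 0 => id
  | n + 1 => S.prefixMap d n ∘ S.f (d n)

/-- `d : ℕ → ℕ` (with digits in `{1, …, m}`) is a coding of `x` if
`x = lim_n f_{d 0} ∘ ⋯ ∘ f_{d (n-1)} (0)`. -/
def isCoding (S : ClassE) (d : ℕ → ℕ) (x : ℝ) : Prop :=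
  (∀ n, 1 ≤ d n ∧ d n ≤ S.m) ∧
    Tendsto (fun n => S.prefixMap d n 0) atTop (nhds x)

/-- The set of codings of `x`. -/
def codings (S : ClassE) (x : ℝ) : Set (ℕ → ℕ) := {d | S.isCoding d x}

/-- `U k E`: the set of points of `E` having exactly `k` distinct codings
(`k` a cardinal; e.g. `k = ℵ₀` for countably infinitely many codings,
`k = 𝔠 = 2^ℵ₀` for a continuum of codings). -/
def U (S : ClassE) (k : Cardinal) : Set ℝ :=
  {x ∈ S.E | Cardinal.mk (S.codings x) = k}

end ClassE

open ClassE

namespace ClassE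

def sh (n : ℕ) (d : ℕ → ℕ) : ℕ → ℕ := fun k => d (n + k)

def Dig (S : ClassE) (d : ℕ → ℕ) : Prop := ∀ n, 1 ≤ d n ∧ d n ≤ S.m

def C (S : ClassE) (d : ℕ → ℕ) (x : ℝ) : Prop :=
  S.Dig d ∧ ∀ n, x ∈ S.prefixMap d n '' S.I

theorem pm_add (S : ClassE) (d : ℕ → ℕ) (n k : ℕ) (x : ℝ) :
    S.prefixMap d (n + k) x = S.prefixMap d n (S.prefixMap (sh n d) k x) := by
  induction k generalizing x with
  | zero => rfl
  | succ k ih =>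
    change S.prefixMap d (n + k) (S.f (d (n + k)) x) = _
    rw [ih]; rfl

theorem pm_congr (S : ClassE) {d e : ℕ → ℕ} (n : ℕ) (h : ∀ k < n, d k = e k) :
    S.prefixMap d n = S.prefixMap e n := by
  induction n with
  | zero => rfl
  | succ n ih =>
    change S.prefixMap d n ∘ S.f (d n) = S.prefixMap e n ∘ S.f (e n)
    rw [ih (fun k hk => h k (by omega)), h n (by omega)]

theorem pm_const (S : ClassE) {d : ℕ → ℕ} (i p n : ℕ) (h0 : d 0 = i)
    (h : ∀ k < n, d (1 + k) = p) (x : ℝ) :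
    S.prefixMap d (1 + n) x = S.f i ((S.f p)^[n] x) := by
  induction n generalizing x with
  | zero => simp [prefixMap, h0]
  | succ n ih =>
    change S.prefixMap d (1 + n) (S.f (d (1 + n)) x) = _
    rw [ih (fun k hk => h k (by omega)), h n (by omega)]; rfl

theorem exists_rho (S : ClassE) : ∃ ρ : ℝ, 0 < ρ ∧ ρ < 1 ∧ ∀ i, 1 ≤ i → i ≤ S.m → S.r i ≤ ρ := by
  obtain ⟨i, hi, h⟩ := Finset.exists_max_image (Finset.Icc 1 S.m) S.r
    ⟨1, by have := S.hm; simp; omega⟩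
  rw [Finset.mem_Icc] at hi
  exact ⟨S.r i, (S.hr i hi.1 hi.2).1, (S.hr i hi.1 hi.2).2,
    fun j h1 h2 => h j (Finset.mem_Icc.2 ⟨h1, h2⟩)⟩

theorem pm_affine (S : ClassE) (ρ : ℝ) (hρ : 0 < ρ) (hr : ∀ i, 1 ≤ i → i ≤ S.m → S.r i ≤ ρ)
    {d : ℕ → ℕ} (hd : S.Dig d) (n : ℕ) :
    ∃ α β : ℝ, 0 < α ∧ α ≤ ρ ^ n ∧ ∀ x, S.prefixMap d n x = α * x + β := by
  induction n with
  | zero => exact ⟨1, 0, by simp, by simp, by simp [prefixMap]⟩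
  | succ n ih =>
    obtain ⟨α, β, h0, h1, h⟩ := ih
    have h2 := S.hr (d n) (hd n).1 (hd n).2
    have h3 := hr (d n) (hd n).1 (hd n).2
    refine ⟨α * S.r (d n), α * S.t (d n) + β, mul_pos h0 h2.1, ?_, ?_⟩
    · rw [pow_succ]; exact mul_le_mul h1 h3 h2.1.le (by positivity)
    · intro x
      change S.prefixMap d n (S.f (d n) x) = _
      rw [h, f]; ring

theorem f_inj (S : ClassE) {i : ℕ} (h1 : 1 ≤ i) (h2 : i ≤ S.m) : Function.Injective (S.f i) := by
  intro x y h
  have := (S.hr i h1 h2).1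
  simp only [f, add_left_inj] at h
  exact mul_left_cancel₀ this.ne' h

theorem f_mono (S : ClassE) {i : ℕ} (h1 : 1 ≤ i) (h2 : i ≤ S.m) : StrictMono (S.f i) := by
  intro x y h
  have := (S.hr i h1 h2).1
  simp only [f]
  nlinarith

theorem f_E (S : ClassE) {i : ℕ} (h1 : 1 ≤ i) (h2 : i ≤ S.m) {x : ℝ} (hx : x ∈ S.E) :
    S.f i x ∈ S.E := by
  rw [S.hEinv]
  simp only [Set.mem_iUnion]
  exact ⟨i, Finset.mem_Icc.2 ⟨h1, h2⟩, x, hx, rfl⟩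

theorem a_E (S : ClassE) : S.a ∈ S.E := S.hEcpt.sInf_mem S.hEne
theorem b_E (S : ClassE) : S.b ∈ S.E := S.hEcpt.sSup_mem S.hEne
theorem E_I (S : ClassE) : S.E ⊆ S.I := fun _ hx =>
  ⟨csInf_le S.hEcpt.bddBelow hx, le_csSup S.hEcpt.bddAbove hx⟩

theorem f_I (S : ClassE) {i : ℕ} (h1 : 1 ≤ i) (h2 : i ≤ S.m) {x : ℝ} (hx : x ∈ S.I) :
    S.f i x ∈ S.I :=
  ⟨(S.E_I (S.f_E h1 h2 S.a_E)).1.trans ((S.f_mono h1 h2).monotone hx.1),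
   ((S.f_mono h1 h2).monotone hx.2).trans (S.E_I (S.f_E h1 h2 S.b_E)).2⟩

theorem fit_I (S : ClassE) {i : ℕ} (h1 : 1 ≤ i) (h2 : i ≤ S.m) (n : ℕ) {x : ℝ} (hx : x ∈ S.I) :
    (S.f i)^[n] x ∈ S.I := by
  induction n generalizing x with
  | zero => exact hx
  | succ n ih => exact ih (S.f_I h1 h2 hx)

theorem pm_I (S : ClassE) {d : ℕ → ℕ} (hd : S.Dig d) (n : ℕ) {x : ℝ} (hx : x ∈ S.I) :
    S.prefixMap d n x ∈ S.I := by
  induction n generalizing x with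
  | zero => exact hx
  | succ n ih => exact ih (S.f_I (hd n).1 (hd n).2 hx)

theorem pm_inj (S : ClassE) {d : ℕ → ℕ} (hd : S.Dig d) (n : ℕ) :
    Function.Injective (S.prefixMap d n) := by
  induction n with
  | zero => exact Function.injective_id
  | succ n ih => exact ih.comp (S.f_inj (hd n).1 (hd n).2)

theorem pm_cont (S : ClassE) (d : ℕ → ℕ) (n : ℕ) : Continuous (S.prefixMap d n) := by
  induction n with
  | zero => exact continuous_id
  | succ n ih =>
    refine ih.comp ?_
    unfold f; fun_prop

theorem coding_iff (S : ClassE) (d : ℕ → ℕ) (x : ℝ) : S.isCoding d x ↔ S.C d x := by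
  refine and_congr_right fun hd => ?_
  obtain ⟨ρ, h0, h1, hρ⟩ := S.exists_rho
  have hlim : ∀ M : ℝ, Tendsto (fun n => ρ ^ n * M) atTop (nhds 0) := fun M => by
    simpa using (tendsto_pow_atTop_nhds_zero_of_lt_one h0.le h1).mul_const M
  constructor
  · intro h n
    have ha : Tendsto (fun n => S.prefixMap d n S.a) atTop (nhds x) := by
      have : Tendsto (fun n => S.prefixMap d n S.a - S.prefixMap d n 0) atTop (nhds 0) := by
        refine squeeze_zero_norm (fun n => ?_) (hlim |S.a|)
        obtain ⟨α, β, hα, hα', he⟩ := S.pm_affine ρ h0 hρ hd n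
        rw [he, he]
        have : α * S.a + β - (α * 0 + β) = α * S.a := by ring
        rw [this, Real.norm_eq_abs, abs_mul, abs_of_pos hα]
        gcongr
      simpa using this.add h
    have hc : IsClosed (S.prefixMap d n '' S.I) :=
      (isCompact_Icc.image (S.pm_cont d n)).isClosed
    refine hc.mem_of_tendsto ha ?_
    filter_upwards [eventually_ge_atTop n] with k hk
    obtain ⟨k, rfl⟩ := Nat.exists_eq_add_of_le hk
    rw [pm_add]
    exact ⟨_, S.pm_I (fun j => hd _) k (S.E_I S.a_E), rfl⟩
  · intro h
    have : Tendsto (fun n => S.prefixMap d n 0 - x) atTop (nhds 0) := by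
      refine squeeze_zero_norm (fun n => ?_) (hlim (max |S.a| |S.b|))
      obtain ⟨z, hz, hx⟩ := h n
      obtain ⟨α, β, hα, hα', he⟩ := S.pm_affine ρ h0 hρ hd n
      rw [← hx, he, he]
      have : α * 0 + β - (α * z + β) = - (α * z) := by ring
      rw [this, Real.norm_eq_abs, abs_neg, abs_mul, abs_of_pos hα]
      have := abs_le_max_abs_abs hz.1 hz.2
      gcongr
    simpa using this.add_const x

theorem C_unique (S : ClassE) {d : ℕ → ℕ} {x y : ℝ} (hx : S.C d x) (hy : S.C d y) : x = y :=
  tendsto_nhds_unique ((S.coding_iff d x).2 hx).2 ((S.coding_iff d y).2 hy).2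

theorem C_I (S : ClassE) {d : ℕ → ℕ} {x : ℝ} (hx : S.C d x) : x ∈ S.I := by
  obtain ⟨z, hz, rfl⟩ := hx.2 0
  exact hz

theorem C_shift (S : ClassE) {d : ℕ → ℕ} {x : ℝ} (hx : S.C d x) (n : ℕ) :
    ∃ y, x = S.prefixMap d n y ∧ S.C (sh n d) y := by
  obtain ⟨y, hy, hxy⟩ := hx.2 n
  refine ⟨y, hxy.symm, fun k => hx.1 _, fun k => ?_⟩
  obtain ⟨z, hz, h⟩ := hx.2 (n + k)
  rw [pm_add] at h
  exact ⟨z, hz, S.pm_inj hx.1 n (h.trans hxy.symm)⟩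

theorem C_of_shift (S : ClassE) {d : ℕ → ℕ} {y : ℝ} (n : ℕ) (hd : S.Dig d)
    (hy : S.C (sh n d) y) : S.C d (S.prefixMap d n y) := by
  refine ⟨hd, fun k => ?_⟩
  obtain ⟨z, hz, h⟩ := hy.2 k
  refine ⟨S.prefixMap (sh k d) n z, S.pm_I (fun j => hd _) n hz, ?_⟩
  rw [← h, ← pm_add, ← pm_add, Nat.add_comm]

theorem C_head (S : ClassE) {d : ℕ → ℕ} {x : ℝ} (hx : S.C d x) : x ∈ S.f (d 0) '' S.I := hx.2 1

def Over (S : ClassE) (i j : ℕ) : Prop :=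
  (1 ≤ i ∧ i ≤ S.m) ∧ (1 ≤ j ∧ j ≤ S.m) ∧ i ≠ j ∧ (S.f i '' S.I ∩ S.f j '' S.I).Nonempty

def en (S : ClassE) (i j : ℕ) : ℕ := if i < j then S.m else 1

theorem Over.symm {S : ClassE} {i j : ℕ} (h : S.Over i j) : S.Over j i :=
  ⟨h.2.1, h.1, h.2.2.1.symm, by rw [Set.inter_comm]; exact h.2.2.2⟩

theorem a_lt_b (S : ClassE) (hS : S.goodE) : S.a < S.b := by
  have := hS.1.2.2.1
  exact (S.f_mono (by have := S.hm; omega) le_rfl).lt_iff_lt.1 this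

theorem fa_lt (S : ClassE) (hS : S.goodE) {i j : ℕ} (h1 : 1 ≤ i) (h : i < j) (h2 : j ≤ S.m) :
    S.f i S.a < S.f j S.a := by
  induction j, h using Nat.le_induction with
  | base => exact hS.1.2.1 i h1 (by omega)
  | succ j hj ih =>
    exact (ih (by omega)).trans (hS.1.2.1 j (by omega) (by omega))

theorem not_over (S : ClassE) (hS : S.goodE) {i j : ℕ} (h1 : 1 ≤ i) (h : i + 2 ≤ j) (h2 : j ≤ S.m) :
    ∀ x, x ∈ S.f i '' S.I → x ∈ S.f j '' S.I → False := by
  rintro _ ⟨y, hy, rfl⟩ ⟨z, hz, hyz⟩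
  have e1 := (S.f_mono h1 (by omega : i ≤ S.m)).monotone hy.2
  have e2 := (S.f_mono (by omega : 1 ≤ j) h2).monotone hz.1
  have e3 : S.f (i + 2) S.a ≤ S.f j S.a := by
    rcases h.eq_or_lt with rfl | h'
    · rfl
    · exact (S.fa_lt hS (by omega) h' h2).le
  have e4 : S.f i S.a < S.f (i + 2) S.a := S.fa_lt hS h1 (by omega) (by omega)
  have hab := (S.a_lt_b hS).le
  have e5 : S.f (i + 2) S.a ∈ S.f i '' S.I := by
    have : ContinuousOn (S.f i) (Set.Icc S.a S.b) := by unfold f; fun_prop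
    exact intermediate_value_Icc hab this ⟨e4.le, by linarith⟩
  have := hS.2.1 i h1 (by omega)
  have hmem : S.f (i + 2) S.a ∈ S.f i '' S.I ∩ S.f (i + 2) '' S.I :=
    ⟨e5, ⟨_, ⟨le_rfl, hab⟩, rfl⟩⟩
  rw [this] at hmem
  exact hmem

theorem over_adj (S : ClassE) (hS : S.goodE) {i j : ℕ} (h : S.Over i j) : j = i + 1 ∨ i = j + 1 := by
  obtain ⟨h1, h2, h3, x, hx, hy⟩ := h
  by_contra hc
  rcases Nat.lt_or_ge i j with h | h
  · exact S.not_over hS h1.1 (by omega) h2.2 x hx hy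
  · exact S.not_over hS h2.1 (by omega) h1.2 x hy hx

theorem fit_affine (S : ClassE) {i p : ℕ} (hi : 1 ≤ i ∧ i ≤ S.m) (hp : 1 ≤ p ∧ p ≤ S.m) (n : ℕ) :
    ∃ α β : ℝ, 0 < α ∧ ∀ x, S.f i ((S.f p)^[n] x) = α * x + β := by
  induction n with
  | zero => exact ⟨S.r i, S.t i, (S.hr i hi.1 hi.2).1, fun x => rfl⟩
  | succ n ih =>
    obtain ⟨α, β, h0, h⟩ := ih
    refine ⟨α * S.r p, α * S.t p + β, mul_pos h0 (S.hr p hp.1 hp.2).1, fun x => ?_⟩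
    rw [Function.iterate_succ_apply, h, f]; ring

theorem aff_eq {α β α' β' a b : ℝ} (hab : a < b) (h0 : 0 < α) (h0' : 0 < α') {g g' : ℝ → ℝ}
    (hg : ∀ x, g x = α * x + β) (hg' : ∀ x, g' x = α' * x + β')
    (h : g '' Set.Icc a b = g' '' Set.Icc a b) : g = g' := by
  have e : g = fun x => α * x + β := funext hg
  have e' : g' = fun x => α' * x + β' := funext hg'
  rw [e, e', Set.image_affine_Icc' h0, Set.image_affine_Icc' h0'] at h
  have hle : α * a + β ≤ α * b + β := by nlinarith
  have hle' : α' * a + β' ≤ α' * b + β' := by nlinarith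
  have h1 := congrArg sInf h
  have h2 := congrArg sSup h
  rw [csInf_Icc hle, csInf_Icc hle'] at h1
  rw [csSup_Icc hle, csSup_Icc hle'] at h2
  have : α = α' := by
    have : (α - α') * (b - a) = 0 := by linarith
    rcases mul_eq_zero.1 this with h | h <;> linarith
  subst this
  have : β = β' := by linarith
  subst this
  rw [e, e']

theorem over_data (S : ClassE) (hS : S.goodE) {i j : ℕ} (h : S.Over i j) :
    ∃ u v : ℕ, 1 ≤ u ∧ 1 ≤ v ∧
      S.f i '' S.I ∩ S.f j '' S.I = (S.f i ∘ (S.f (S.en i j))^[u]) '' S.I ∧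
      ∀ x, S.f i ((S.f (S.en i j))^[u] x) = S.f j ((S.f (S.en j i))^[v] x) := by
  have key : ∀ i, 1 ≤ i → i + 1 ≤ S.m → S.f i '' S.I ∩ S.f (i + 1) '' S.I ≠ ∅ →
    ∃ u v : ℕ, 1 ≤ u ∧ 1 ≤ v ∧
      S.f i '' S.I ∩ S.f (i + 1) '' S.I = (S.f i ∘ (S.f S.m)^[u]) '' S.I ∧
      S.f i '' S.I ∩ S.f (i + 1) '' S.I = (S.f (i + 1) ∘ (S.f 1)^[v]) '' S.I ∧
      ∀ x, S.f i ((S.f S.m)^[u] x) = S.f (i + 1) ((S.f 1)^[v] x) := by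
    intro i h1 h2 h3
    obtain ⟨u, v, hu, hv, hA, hB⟩ := hS.2.2.2 i h1 h2 h3
    refine ⟨u, v, hu, hv, hA, hB, ?_⟩
    have hm := S.hm
    obtain ⟨α, β, h0, hg⟩ := S.fit_affine (i := i) (p := S.m) ⟨h1, by omega⟩ ⟨by omega, le_rfl⟩ u
    obtain ⟨α', β', h0', hg'⟩ := S.fit_affine (i := i + 1) (p := 1) ⟨by omega, h2⟩
      ⟨le_rfl, by omega⟩ v
    exact congrFun (aff_eq (S.a_lt_b hS) h0 h0' hg hg' (hA.symm.trans hB))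
  obtain ⟨h1, h2, h3, hne⟩ := id h
  rcases S.over_adj hS h with rfl | rfl
  · obtain ⟨u, v, hu, hv, hA, hB, hC⟩ := key i h1.1 h2.2 hne.ne_empty
    refine ⟨u, v, hu, hv, ?_, ?_⟩ <;> simp only [en, Nat.lt_succ_self, if_true]
    · exact hA
    · simpa using hC
  · rw [Set.inter_comm] at hne ⊢
    obtain ⟨u, v, hu, hv, hA, hB, hC⟩ := key j h2.1 h1.2 hne.ne_empty
    refine ⟨v, u, hv, hu, ?_, ?_⟩ <;> simp only [en, Nat.lt_succ_self, if_true]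
    · simpa using hB
    · simpa using fun x => (hC x).symm

def op (S : ClassE) (p : ℕ) : ℕ := if p = 1 then S.m else 1
def nb (S : ClassE) (p : ℕ) : ℕ := if p = 1 then 2 else S.m - 1

theorem ends (S : ClassE) (hS : S.goodE) {p j : ℕ} (hp : p = 1 ∨ p = S.m) (h : S.Over p j) :
    j = S.nb p ∧ S.en p j = S.op p ∧ S.en j p = p := by
  have hm := S.hm
  have := S.over_adj hS h
  obtain ⟨h1, h2, h3, -⟩ := h
  unfold nb en op
  rcases hp with rfl | rfl
  · have : j = 2 := by omega
    subst this; simp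
  · have : j = S.m - 1 := by omega
    subst this
    have e1 : ¬ (S.m = 1) := by omega
    have e2 : ¬ (S.m < S.m - 1) := by omega
    have e3 : (S.m - 1 < S.m) := by omega
    simp [e1, e2, e3]

theorem op_disj (S : ClassE) (hS : S.goodE) {p : ℕ} (hp : p = 1 ∨ p = S.m) (x : ℝ) :
    x ∈ S.f p '' S.I → x ∈ S.f (S.op p) '' S.I → False := by
  have hm := S.hm
  unfold op
  rcases hp with rfl | rfl
  · simpa using S.not_over hS (i := 1) (j := S.m) le_rfl (by omega) le_rfl x
  · have e1 : ¬ (S.m = 1) := by omega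
    simp only [e1, if_false]
    exact fun h1 h2 => S.not_over hS (i := 1) (j := S.m) le_rfl (by omega) le_rfl x h2 h1

theorem endL (S : ClassE) (hS : S.goodE) {p j k : ℕ} (hp : p = 1 ∨ p = S.m)
    (hj : 1 ≤ j ∧ j ≤ S.m) (hjp : j ≠ p) {z : ℝ} (hz : z ∈ S.I)
    (h : (S.f p)^[k + 1] z ∈ S.f j '' S.I) : k = 0 ∧ S.Over p j := by
  have hm := S.hm
  have hp' : 1 ≤ p ∧ p ≤ S.m := by omega
  have hmem : (S.f p)^[k + 1] z ∈ S.f p '' S.I ∩ S.f j '' S.I := by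
    refine ⟨⟨_, S.fit_I hp'.1 hp'.2 k hz, ?_⟩, h⟩
    rw [Function.iterate_succ_apply']
  have ho : S.Over p j := ⟨hp', hj, hjp.symm, _, hmem⟩
  refine ⟨?_, ho⟩
  obtain ⟨u, v, hu, hv, hA, -⟩ := S.over_data hS ho
  rw [hA, (S.ends hS hp ho).2.1] at hmem
  obtain ⟨w, hw, he⟩ := hmem
  rw [Function.iterate_succ_apply'] at he
  have he' := S.f_inj hp'.1 hp'.2 he
  by_contra hk
  obtain ⟨k, rfl⟩ := Nat.exists_eq_succ_of_ne_zero hk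
  obtain ⟨u, rfl⟩ := Nat.exists_eq_add_of_le' hu
  have hop : 1 ≤ S.op p ∧ S.op p ≤ S.m := by unfold op; split_ifs <;> omega
  refine S.op_disj hS hp ((S.f p)^[k + 1] z) ⟨_, S.fit_I hp'.1 hp'.2 k hz, ?_⟩ ?_
  · rw [Function.iterate_succ_apply']
  · rw [← he', Function.iterate_succ_apply']
    exact ⟨_, S.fit_I hop.1 hop.2 u hw, rfl⟩

theorem sh_sh (A n : ℕ) (d : ℕ → ℕ) : sh n (sh A d) = sh (A + n) d := by
  funext k; simp [sh, Nat.add_assoc]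

def cat (n : ℕ) (d s : ℕ → ℕ) : ℕ → ℕ := fun k => if k < n then d k else s (k - n)

theorem sh_cat (n : ℕ) (d s : ℕ → ℕ) : sh n (cat n d s) = s := by
  funext k; simp [sh, cat]

theorem cat_lt {n k : ℕ} (d s : ℕ → ℕ) (h : k < n) : cat n d s k = d k := by simp [cat, h]

theorem eq_cat {n : ℕ} {d e : ℕ → ℕ} (h : ∀ k < n, d k = e k) : d = cat n e (sh n d) := by
  funext k
  by_cases hk : k < n
  · simp [cat, hk, h]
  · simp only [cat, hk, if_false, sh]; congr 1; omega

theorem C_cat (S : ClassE) {n : ℕ} {d s : ℕ → ℕ} {y : ℝ} (hd : ∀ k < n, 1 ≤ d k ∧ d k ≤ S.m)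
    (hs : S.C s y) : S.C (cat n d s) (S.prefixMap d n y) := by
  rw [← S.pm_congr (d := cat n d s) n (fun k hk => cat_lt d s hk)]
  refine S.C_of_shift n (fun k => ?_) (by rwa [sh_cat])
  by_cases hk : k < n
  · rw [cat_lt d s hk]; exact hd k hk
  · simp only [cat, hk, if_false]; exact hs.1 _

theorem en_dig (S : ClassE) (i j : ℕ) : 1 ≤ S.en i j ∧ S.en i j ≤ S.m := by
  have := S.hm
  unfold en; split_ifs <;> omega

theorem en_or (S : ClassE) (i j : ℕ) : S.en i j = 1 ∨ S.en i j = S.m := by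
  unfold en; split_ifs <;> simp

/-- Block `j p^w` followed by `s`. -/
def blk (j p w : ℕ) (s : ℕ → ℕ) : ℕ → ℕ := cat (1 + w) (fun k => if k = 0 then j else p) s

theorem C_blk (S : ClassE) {j p w : ℕ} (hj : 1 ≤ j ∧ j ≤ S.m) (hp : 1 ≤ p ∧ p ≤ S.m)
    {s : ℕ → ℕ} {y : ℝ} (hs : S.C s y) : S.C (blk j p w s) (S.f j ((S.f p)^[w] y)) := by
  have := S.C_cat (n := 1 + w) (d := fun k => if k = 0 then j else p)
    (fun k _ => by split_ifs <;> assumption) hs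
  rwa [S.pm_const j p w (by simp) (fun k _ => by simp)] at this

theorem blk_zero (j p w : ℕ) (s : ℕ → ℕ) : blk j p w s 0 = j := by simp [blk, cat]

theorem eq_blk {j p w : ℕ} {d : ℕ → ℕ} (h0 : d 0 = j) (h : ∀ k < w, d (1 + k) = p) :
    d = blk j p w (sh (1 + w) d) := by
  refine eq_cat fun k hk => ?_
  rcases k with _ | k
  · simpa using h0
  · have := h k (by omega)
    rw [Nat.add_comm] at this
    simpa using this

def Sw (S : ClassE) (s : ℕ → ℕ) : Prop := ∃ j u v, S.Over (s 0) j ∧ 1 ≤ u ∧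
  (∀ x, S.f (s 0) ((S.f (S.en (s 0) j))^[u] x) = S.f j ((S.f (S.en j (s 0)))^[v] x)) ∧
  ∀ k < u, s (1 + k) = S.en (s 0) j

theorem swap (S : ClassE) {d : ℕ → ℕ} {x : ℝ} (hd : S.C d x) {n : ℕ} (h : S.Sw (sh n d)) :
    ∃ e, S.C e x ∧ e ≠ d ∧ (∀ k < n, e k = d k) ∧ ∃ A B, sh A e = sh B d := by
  obtain ⟨y, rfl, hy⟩ := S.C_shift hd n
  obtain ⟨j, u, v, ho, hu, heq, hk⟩ := h
  obtain ⟨z, hyz, hz⟩ := S.C_shift hy (1 + u)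
  rw [S.pm_const _ _ u rfl hk, heq] at hyz
  have h1 := S.C_blk (w := v) ho.2.1 (S.en_dig j (sh n d 0)) hz
  rw [← hyz] at h1
  refine ⟨cat n d (blk j (S.en j (sh n d 0)) v (sh (1 + u) (sh n d))), S.C_cat (fun k _ => hd.1 k) h1,
    ?_, fun k hk => cat_lt _ _ hk, n + (1 + v), n + (1 + u), ?_⟩
  · intro he
    have := congrFun he n
    simp only [cat, lt_irrefl, if_false, Nat.sub_self, blk_zero] at this
    exact ho.2.2.1 (by simp [sh, this])
  · rw [← sh_sh, sh_cat, blk, sh_cat, sh_sh]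

theorem nhds_cyl (d : ℕ → ℕ) (V : Set (ℕ → ℕ)) (hV : V ∈ nhds d) :
    ∃ N, ∀ e : ℕ → ℕ, (∀ k < N, e k = d k) → e ∈ V := by
  obtain ⟨W, ⟨c, N, rfl⟩, hd, hW⟩ :=
    (PiNat.isTopologicalBasis_cylinders (fun _ : ℕ => ℕ)).mem_nhds_iff.1 hV
  refine ⟨N, fun e he => hW ?_⟩
  rw [PiNat.mem_cylinder_iff] at hd ⊢
  exact fun i hi => (he i hi).trans (hd i hi)

theorem cyl_nhds (d : ℕ → ℕ) (N : ℕ) : {e : ℕ → ℕ | ∀ k < N, e k = d k} ∈ nhds d :=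
  (PiNat.isOpen_cylinder (fun _ : ℕ => ℕ) d N).mem_nhds (PiNat.self_mem_cylinder d N)

theorem K_closed (S : ClassE) (x : ℝ) : IsClosed {d | S.C d x} := by
  rw [← isOpen_compl_iff, isOpen_iff_mem_nhds]
  intro d hd
  simp only [Set.mem_compl_iff, Set.mem_ofPred_eq, C, not_and_or, Dig, not_forall] at hd
  rcases hd with ⟨n, hn⟩ | ⟨n, hn⟩
  · filter_upwards [cyl_nhds d (n + 1)] with e he hc
    have := hc.1 n
    rw [he n (by omega)] at this
    tauto
  · filter_upwards [cyl_nhds d n] with e he hc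
    apply hn
    rw [← S.pm_congr n he]
    exact hc.2 n

theorem K_compact (S : ClassE) (x : ℝ) : IsCompact {d | S.C d x} := by
  have : IsCompact (Set.univ.pi fun _ : ℕ => Set.Icc 1 S.m) :=
    isCompact_univ_pi fun _ => (Set.finite_Icc _ _).isCompact
  exact this.of_isClosed_subset (S.K_closed x) fun d hd n _ => hd.1 n

theorem inf_swap (S : ClassE) {d : ℕ → ℕ} {x : ℝ} (hd : S.C d x)
    (h : ∀ N, ∃ n ≥ N, S.Sw (sh n d)) : ¬ {d | S.C d x}.Countable := by
  intro hc
  let Q : Set (ℕ → ℕ) := {d | S.C d x ∧ ∀ N, ∃ n ≥ N, S.Sw (sh n d)}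
  have hQ : Preperfect Q := by
    rw [preperfect_iff_nhds]
    rintro e ⟨he, hs⟩ V hV
    obtain ⟨N, hN⟩ := nhds_cyl e V hV
    obtain ⟨n, hn, hsn⟩ := hs N
    obtain ⟨e', h1, h2, h3, A, B, h4⟩ := S.swap he hsn
    refine ⟨e', ⟨hN e' fun k hk => h3 k (by omega), h1, fun M => ?_⟩, h2⟩
    obtain ⟨l, hl, hsl⟩ := hs (B + M)
    obtain ⟨k, rfl⟩ := Nat.exists_eq_add_of_le (show B ≤ l by omega)
    refine ⟨A + k, by omega, ?_⟩
    rwa [← sh_sh, h4, sh_sh]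
  let _ := TopologicalSpace.upgradeIsCompletelyMetrizable (ℕ → ℕ)
  obtain ⟨g, hg, -, hinj⟩ := hQ.perfect_closure.exists_nat_bool_injection
    ⟨d, subset_closure ⟨hd, h⟩⟩
  have hcl : closure Q ⊆ {d | S.C d x} := closure_minimal (fun e he => he.1) (S.K_closed x)
  have h1 : (Set.range g).Countable := hc.mono (hg.trans hcl)
  rw [← Set.image_univ] at h1
  have he : Cardinal.mk (ℕ → Bool) = Cardinal.continuum := by simp
  have h2 := Set.countable_univ_iff.1 (Set.countable_of_injective_of_countable_image hinj.injOn h1)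
  have h3 := Cardinal.mk_le_aleph0_iff.2 h2
  rw [he] at h3
  exact absurd h3 (not_le.2 Cardinal.aleph0_lt_continuum)

theorem walk (S : ClassE) (hS : S.goodE) {s : ℕ → ℕ} {i p u k : ℕ} {z : ℝ} (hz : z ∈ S.I)
    (hp : p = 1 ∨ p = S.m)
    (hs : S.C s (S.f i ((S.f p)^[u] z))) (h0 : s 0 = i) (hk : k < u) (h : ∀ l < k, s (1 + l) = p)
    (hne : s (1 + k) ≠ p) :
    k + 1 = u ∧ S.Over p (s (1 + k)) ∧ S.C (sh (1 + k) s) (S.f p z) := by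
  have hm := S.hm
  have hp' : 1 ≤ p ∧ p ≤ S.m := by omega
  obtain ⟨y, hy, hc⟩ := S.C_shift hs (1 + k)
  rw [S.pm_const i p k h0 h] at hy
  have hi := hs.1 0
  rw [h0] at hi
  have hy' := S.f_inj hi.1 hi.2 hy
  obtain ⟨w, rfl⟩ := Nat.exists_eq_add_of_lt hk
  rw [Nat.add_assoc, Function.iterate_add_apply] at hy'
  have hy'' := (S.f_inj hp'.1 hp'.2).iterate k hy'
  have hh := S.C_head hc
  rw [← hy''] at hh hc
  obtain ⟨rfl, ho⟩ := S.endL hS hp (hc.1 0) (by simpa [sh] using hne) hz hh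
  exact ⟨by omega, by simpa [sh] using ho, by simpa using hc⟩

def T (S : ClassE) (i j : ℕ) (s : ℕ → ℕ) : Prop :=
  s 0 = i ∧ S.Over i j ∧ (∀ n, ¬ S.Sw (sh n s)) ∧ ∃ y ∈ S.f i '' S.I ∩ S.f j '' S.I, S.C s y

theorem T_step (S : ClassE) (hS : S.goodE) {i j u v : ℕ} {s : ℕ → ℕ} (hs : S.T i j s)
    (hu : 1 ≤ u)
    (hA : S.f i '' S.I ∩ S.f j '' S.I = (S.f i ∘ (S.f (S.en i j))^[u]) '' S.I)
    (hB : ∀ x, S.f i ((S.f (S.en i j))^[u] x) = S.f j ((S.f (S.en j i))^[v] x)) :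
    (∀ k, k + 1 < u → s (1 + k) = S.en i j) ∧ s u = S.nb (S.en i j) ∧
      S.T (S.nb (S.en i j)) (S.en i j) (sh u s) := by
  obtain ⟨h0, ho, hn, y, hy, hc⟩ := hs
  subst h0
  have hex : ∃ k, k < u ∧ s (1 + k) ≠ S.en (s 0) j := by
    by_contra hcon
    push Not at hcon
    exact hn 0 ⟨j, u, v, by simpa [sh] using ho, hu, by simpa [sh] using hB,
      by simpa [sh] using hcon⟩
  classical
  obtain ⟨hk, hne⟩ := Nat.find_spec hex
  have hmin : ∀ l < Nat.find hex, s (1 + l) = S.en (s 0) j := by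
    intro l hl
    have := Nat.find_min hex hl
    by_contra hh
    exact this ⟨by omega, hh⟩
  generalize Nat.find hex = k at hk hne hmin
  rw [hA] at hy
  obtain ⟨z, hz, rfl⟩ := hy
  have hp := S.en_or (s 0) j
  obtain ⟨rfl, hov, hC⟩ := S.walk hS hz hp hc rfl hk hmin hne
  have hnb := (S.ends hS hp hov).1
  have e : s (k + 1) = S.nb (S.en (s 0) j) := by rw [← hnb, Nat.add_comm]
  rw [Nat.add_comm 1 k] at hC
  refine ⟨fun l hl => hmin l (by omega), e, by simpa [sh] using e, ?_, fun n => ?_, _, ⟨?_, ?_⟩, hC⟩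
  · rw [← hnb]; exact hov.symm
  · rw [sh_sh]; exact hn _
  · have := S.C_head hC
    rwa [sh, Nat.add_zero, e] at this
  · exact ⟨z, hz, rfl⟩

theorem T_unique (S : ClassE) (hS : S.goodE) (k : ℕ) : ∀ {i j : ℕ} {s s' : ℕ → ℕ},
    S.T i j s → S.T i j s' → s k = s' k := by
  induction k using Nat.strong_induction_on with
  | _ k ih =>
    intro i j s s' h h'
    obtain ⟨u, v, hu, hv, hA, hB⟩ := S.over_data hS h.2.1
    obtain ⟨a1, a2, a3⟩ := S.T_step hS h hu hA hB
    obtain ⟨b1, b2, b3⟩ := S.T_step hS h' hu hA hB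
    rcases Nat.eq_zero_or_pos k with rfl | hk
    · rw [h.1, h'.1]
    · rcases Nat.lt_or_ge k u with hku | hku
      · obtain ⟨l, rfl⟩ := Nat.exists_eq_add_of_le hk
        rw [a1 l (by omega), b1 l (by omega)]
      · have := ih (k - u) (by omega) a3 b3
        simpa [sh, Nat.add_sub_cancel' hku] using this

theorem count_part (S : ClassE) (hS : S.goodE) :
    {x | {d | S.C d x}.Countable ∧ {d | S.C d x}.Infinite}.Countable := by
  have hD : {d : ℕ → ℕ | ∃ n i j, S.T i j (sh n d)}.Countable := by
    simp only [Set.ofPred_exists]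
    refine Set.countable_iUnion fun n => Set.countable_iUnion fun i => Set.countable_iUnion fun j => ?_
    refine Set.MapsTo.countable_of_injOn (t := Set.univ) (f := fun d => fun k : Fin n => d k)
      (fun _ _ => Set.mem_univ _) ?_ (Set.countable_univ)
    intro d hd e he hde
    have h1 : ∀ k < n, d k = e k := fun k hk => congrFun hde ⟨k, hk⟩
    have h2 : sh n d = sh n e := funext fun k => S.T_unique hS k hd he
    rw [eq_cat h1, h2]
    exact (eq_cat fun k _ => rfl).symm
  have : (⋃ d ∈ {d : ℕ → ℕ | ∃ n i j, S.T i j (sh n d)}, {x | S.C d x}).Countable :=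
    hD.biUnion fun d _ => Set.Subsingleton.countable fun x hx y hy => S.C_unique hx hy
  refine this.mono ?_
  rintro x ⟨hc, hi⟩
  obtain ⟨d, hd, hacc⟩ := hi.exists_accPt_of_subset_isCompact (S.K_compact x) subset_rfl
  have hd' : S.C d x := hd
  simp only [Set.mem_iUnion]
  have : ∃ N, ∀ n ≥ N, ¬ S.Sw (sh n d) := by
    by_contra hcon
    push Not at hcon
    exact S.inf_swap hd' hcon hc
  obtain ⟨N, hN⟩ := this
  obtain ⟨e, ⟨he1, he2⟩, hne⟩ := accPt_iff_nhds.1 hacc _ (cyl_nhds d N)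
  have hex : ∃ n, d n ≠ e n := by
    by_contra hcon
    push Not at hcon
    exact hne (funext hcon).symm
  classical
  have h1 := Nat.find_spec hex
  have h2 : ∀ k < Nat.find hex, d k = e k := fun k hk => not_not.1 (Nat.find_min hex hk)
  set n := Nat.find hex
  have hNn : N ≤ n := by
    by_contra hlt
    exact h1 (he1 n (by omega)).symm
  obtain ⟨y, hy, hcy⟩ := S.C_shift hd' n
  obtain ⟨y', hy', hcy'⟩ := S.C_shift he2 n
  rw [← S.pm_congr n h2] at hy'
  obtain rfl : y = y' := S.pm_inj hd'.1 n (hy.symm.trans hy')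
  have m1 := S.C_head hcy
  have m2 := S.C_head hcy'
  simp only [sh, Nat.add_zero] at m1 m2
  exact ⟨d, ⟨n, d n, e n, rfl, ⟨hd'.1 n, he2.1 n, h1, y, m1, m2⟩, fun l => by
    rw [sh_sh]; exact hN _ (by omega), y, ⟨m1, m2⟩, hcy⟩, hd'⟩

theorem end_unique (S : ClassE) (hS : S.goodE) {q : ℕ} (hq : q = 1 ∨ q = S.m) {c : ℝ}
    (hc : c ∈ S.I) (hfc : S.f q c = c) {d : ℕ → ℕ} (hd : S.C d c) : d = fun _ => q := by
  have hm := S.hm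
  have step : ∀ d, S.C d c → d 0 = q ∧ S.C (sh 1 d) c := by
    intro d hd
    have h0 : d 0 = q := by
      by_contra hne
      have := S.C_head hd
      have h2 : (S.f q)^[1 + 1] c ∈ S.f (d 0) '' S.I := by simpa [hfc] using this
      simpa using (S.endL hS hq (hd.1 0) hne hc h2).1
    refine ⟨h0, ?_⟩
    obtain ⟨y, hy, hcy⟩ := S.C_shift hd 1
    have : S.f q c = S.f q y := by rw [hfc]; simpa [prefixMap, h0] using hy
    rw [S.f_inj (by omega) (by omega) this]
    exact hcy
  have all : ∀ n, S.C (sh n d) c := by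
    intro n
    induction n with
    | zero => (have e : sh 0 d = d := funext fun k => by simp [sh]); rwa [e]
    | succ n ih => have := (step _ ih).2; rwa [sh_sh] at this
  funext n
  simpa [sh] using (step _ (all n)).1

theorem const_C (S : ClassE) {q : ℕ} (hq : 1 ≤ q ∧ q ≤ S.m) {c : ℝ}
    (hc : c ∈ S.I) (hfc : S.f q c = c) : S.C (fun _ => q) c := by
  refine ⟨fun _ => hq, fun n => ⟨c, hc, ?_⟩⟩
  induction n with
  | zero => rfl
  | succ n ih =>
    change S.prefixMap _ n (S.f q c) = c
    rw [hfc, ih]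

theorem base_pt (S : ClassE) (hS : S.goodE) {p j : ℕ} (hp : p = 1 ∨ p = S.m) (ho : S.Over p j)
    {c : ℝ} (hc : c ∈ S.I) (hfc : S.f (S.op p) c = c) :
    {d | S.C d (S.f p c)}.Countable ∧ {d | S.C d (S.f p c)}.Infinite := by
  have hm := S.hm
  have hp' := ho.1
  have hopd : S.op p = 1 ∨ S.op p = S.m := by unfold op; split_ifs <;> simp
  have hopd' : 1 ≤ S.op p ∧ S.op p ≤ S.m := by omega
  obtain ⟨u, v, hu, hv, hA, hB⟩ := S.over_data hS ho
  obtain ⟨hj, he1, he2⟩ := S.ends hS hp ho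
  rw [he1, he2] at hB
  have hBc := hB c
  rw [Function.iterate_fixed hfc] at hBc
  obtain ⟨w, rfl⟩ := Nat.exists_eq_add_of_le' hv
  set base := blk p p 0 (fun _ => S.op p) with hbase
  have hbC : S.C base (S.f p c) := by
    simpa using S.C_blk (w := 0) hp' hp' (S.const_C hopd' hc hfc)
  have hG : ∀ d, S.C d (S.f p c) → S.C (blk j p w d) (S.f p c) := by
    intro d hd
    have := S.C_blk (w := w) ho.2.1 hp' hd
    rwa [← Function.iterate_succ_apply, ← hBc] at this
  have hGi : Function.Injective (blk j p w) := by
    intro d e h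
    have := congrArg (sh (1 + w)) h
    rwa [blk, blk, sh_cat, sh_cat] at this
  have hcl : ∀ d, S.C d (S.f p c) → d = base ∨ ∃ d', S.C d' (S.f p c) ∧ d = blk j p w d' := by
    intro d hd
    by_cases h0 : d 0 = p
    · left
      rw [eq_blk (w := 0) h0 (by simp)]
      obtain ⟨y, hy, hcy⟩ := S.C_shift hd 1
      have : S.f p c = S.f p y := by simpa [prefixMap, h0] using hy
      rw [← S.f_inj hp'.1 hp'.2 this] at hcy
      rw [hbase, S.end_unique hS hopd hc hfc hcy]
    · right
      have h1 : (S.f p)^[0 + 1] c ∈ S.f (d 0) '' S.I := by simpa using S.C_head hd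
      have ho' := (S.endL hS hp (hd.1 0) h0 hc h1).2
      have h0j : d 0 = j := by rw [hj]; exact (S.ends hS hp ho').1
      have hrun : ∀ k < w, d (1 + k) = p := by
        intro k
        induction k using Nat.strong_induction_on with
        | _ k ih =>
          intro hk
          by_contra hne
          have hd2 := hd
          rw [hBc] at hd2
          have := (S.walk hS hc hp hd2 h0j (by omega) (fun l hl => ih l hl (by omega)) hne).1
          omega
      refine ⟨sh (1 + w) d, ?_, eq_blk h0j hrun⟩
      obtain ⟨y, hy, hcy⟩ := S.C_shift hd (1 + w)
      rw [S.pm_const j p w h0j hrun, hBc, Function.iterate_succ_apply] at hy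
      rw [(S.f_inj hp'.1 hp'.2).iterate w (S.f_inj ho.2.1.1 ho.2.1.2 hy)]
      exact hcy
  constructor
  · have hB : {d | S.C d (S.f p c) ∧ ∀ k, d ≠ (blk j p w)^[k] base}.Subsingleton := by
      have key : ∀ d, d ∈ {d | S.C d (S.f p c) ∧ ∀ k, d ≠ (blk j p w)^[k] base} →
          ∃ d' ∈ {d | S.C d (S.f p c) ∧ ∀ k, d ≠ (blk j p w)^[k] base}, d = blk j p w d' := by
        rintro d ⟨hd, hk⟩
        rcases hcl d hd with h | ⟨d', hd', rfl⟩
        · exact absurd h (hk 0)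
        · refine ⟨d', ⟨hd', fun k h => hk (k + 1) ?_⟩, rfl⟩
          rw [Function.iterate_succ_apply', ← h]
      have agree : ∀ n, ∀ d ∈ {d | S.C d (S.f p c) ∧ ∀ k, d ≠ (blk j p w)^[k] base},
          ∀ e ∈ {d | S.C d (S.f p c) ∧ ∀ k, d ≠ (blk j p w)^[k] base}, d n = e n := by
        intro n
        induction n using Nat.strong_induction_on with
        | _ n ih =>
          intro d hd e he
          obtain ⟨d', hd', rfl⟩ := key d hd
          obtain ⟨e', he', rfl⟩ := key e he
          by_cases hn : n < 1 + w
          · simp [blk, cat, hn]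
          · simp only [blk, cat, hn, if_false]
            exact ih _ (by omega) d' hd' e' he'
      exact fun d hd e he => funext fun n => agree n d hd e he
    refine (hB.countable.union (Set.countable_range fun k => (blk j p w)^[k] base)).mono ?_
    intro d hd
    by_cases h : ∀ k, d ≠ (blk j p w)^[k] base
    · exact Or.inl ⟨hd, h⟩
    · push Not at h
      obtain ⟨k, hk⟩ := h
      exact Or.inr ⟨k, hk.symm⟩
  · intro hfin
    have hsub : blk j p w '' {d | S.C d (S.f p c)} ⊆ {d | S.C d (S.f p c)} := by
      rintro _ ⟨d, hd, rfl⟩; exact hG d hd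
    have := Set.eq_of_subset_of_ncard_le hsub (by rw [Set.ncard_image_of_injective _ hGi]) hfin
    have hb : base ∈ blk j p w '' {d | S.C d (S.f p c)} := by rw [this]; exact hbC
    obtain ⟨d, -, hd⟩ := hb
    have := congrFun hd 0
    rw [blk_zero, hbase, blk_zero] at this
    exact ho.2.2.1 this.symm

theorem inf_pt (S : ClassE) (hS : S.goodE) {p j : ℕ} (hp : p = 1 ∨ p = S.m) (ho : S.Over p j)
    {c : ℝ} (hc : c ∈ S.I) (hfc : S.f (S.op p) c = c) (k : ℕ) :
    {d | S.C d ((S.f p)^[k + 1] c)}.Countable ∧ {d | S.C d ((S.f p)^[k + 1] c)}.Infinite := by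
  have hp' := ho.1
  induction k with
  | zero => simpa using S.base_pt hS hp ho hc hfc
  | succ k ih =>
    have : {d | S.C d ((S.f p)^[k + 1 + 1] c)} = blk p p 0 '' {d | S.C d ((S.f p)^[k + 1] c)} := by
      ext d
      constructor
      · intro hd
        have h0 : d 0 = p := by
          by_contra hne
          have := (S.endL hS hp (hd.1 0) hne hc (S.C_head hd)).1
          omega
        obtain ⟨y, hy, hcy⟩ := S.C_shift hd 1
        have h1 : S.f p ((S.f p)^[k + 1] c) = S.f p y := by
          rw [← Function.iterate_succ_apply' (S.f p)]; rw [hy]; simp [prefixMap, h0]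
        rw [← S.f_inj hp'.1 hp'.2 h1] at hcy
        exact ⟨_, hcy, (eq_blk (w := 0) h0 (by simp)).symm⟩
      · rintro ⟨e, he, rfl⟩
        have := S.C_blk (w := 0) hp' hp' he
        rw [Set.mem_ofPred_eq, Function.iterate_succ_apply']
        simpa using this
    rw [this]
    refine ⟨ih.1.image _, ih.2.image ?_⟩
    intro d _ e _ h
    have := congrArg (sh (1 + 0)) h
    rwa [blk, blk, sh_cat, sh_cat] at this

theorem mem_U (S : ClassE) (x : ℝ) : x ∈ S.U Cardinal.aleph0 ↔
    x ∈ S.E ∧ {d | S.C d x}.Countable ∧ {d | S.C d x}.Infinite := by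
  have : S.codings x = {d | S.C d x} := by ext d; exact S.coding_iff d x
  rw [U, Set.mem_ofPred_eq, this]
  refine and_congr_right fun _ => ?_
  rw [← Set.countable_coe_iff, ← Set.infinite_coe_iff, le_antisymm_iff, Cardinal.mk_le_aleph0_iff,
    Cardinal.aleph0_le_mk_iff]

theorem main_inf (S : ClassE) (hS : S.goodE) {p j : ℕ} (hp : p = 1 ∨ p = S.m) (ho : S.Over p j)
    {c : ℝ} (hc : c ∈ S.E) (hfc : S.f (S.op p) c = c) : (S.U Cardinal.aleph0).Infinite := by
  have hp' := ho.1
  have hcI := S.E_I hc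
  refine Set.infinite_of_injective_forall_mem (f := fun k => (S.f p)^[k + 1] c) ?_ ?_
  · have key : ∀ k l, (S.f p)^[k + 1] c ≠ (S.f p)^[k + (l + 1) + 1] c := by
      intro k l h
      rw [show k + (l + 1) + 1 = (k + 1) + (l + 1) by omega, Function.iterate_add_apply _ (k + 1) (l + 1)] at h
      have h := (S.f_inj hp'.1 hp'.2).iterate _ h
      refine S.op_disj hS hp c ⟨_, S.fit_I hp'.1 hp'.2 l hcI, ?_⟩ ⟨c, hcI, hfc⟩
      rw [← Function.iterate_succ_apply' (S.f p)]; exact h.symm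
    intro k l h
    rcases lt_trichotomy k l with hkl | hkl | hkl
    · obtain ⟨n, rfl⟩ := Nat.exists_eq_add_of_lt hkl
      exact absurd h (key k n)
    · exact hkl
    · obtain ⟨n, rfl⟩ := Nat.exists_eq_add_of_lt hkl
      exact absurd h.symm (key l n)
  · intro k
    rw [mem_U]
    refine ⟨?_, S.inf_pt hS hp ho hcI hfc k⟩
    induction k with
    | zero => exact S.f_E hp'.1 hp'.2 hc
    | succ k ih => rw [Function.iterate_succ_apply']; exact S.f_E hp'.1 hp'.2 ih

end ClassE

theorem stmt18 (S : ClassE) (hS : S.goodE)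
    (h : S.f 1 '' S.I ∩ S.f 2 '' S.I ≠ ∅ ∨ S.f (S.m - 1) '' S.I ∩ S.f S.m '' S.I ≠ ∅) :
    (S.U Cardinal.aleph0).Countable ∧ (S.U Cardinal.aleph0).Infinite := by
  have hm := S.hm
  constructor
  · exact (S.count_part hS).mono fun x hx => ((S.mem_U x).1 hx).2
  · rcases h with h | h
    · exact S.main_inf hS (p := 1) (j := 2) (Or.inl rfl)
        ⟨by omega, by omega, by omega, Set.nonempty_iff_ne_empty.2 h⟩ S.b_E
        (by simpa [op] using hS.1.2.2.2)
    · rw [Set.inter_comm] at h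
      have e1 : ¬ (S.m = 1) := by omega
      exact S.main_inf hS (p := S.m) (j := S.m - 1) (Or.inr rfl)
        ⟨by omega, by omega, by omega, Set.nonempty_iff_ne_empty.2 h⟩ S.a_E
        (by simpa [op, e1] using hS.1.1)
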